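/- Under Assumption 1, for every index a ∈ [K+L], the arm value gap satisfies Δ_a² = 0 if and only if a ∈ I*. Consequently, ordering the arms by their gaps, exactly the L+1 arms in I* have zero gap and all other K−1 arms have strictly positive gap: 0 = Δ_{(1)} = ⋯ = Δ_{(L+1)} < Δ_{(L+2)} ≤ ⋯ ≤ Δ_{(K+L)}. -/

import Mathlib

open Matrix
open scoped ENNReal NNReal

noncomputable section

/-- The objective vector `μ ∈ ℝ^{K+L}` of the standard-form LP: `μ_a = r_a` for `a ∈ [K]`
and `μ_{K+l} = 0` for `l ∈ [L]`. -/
def lpMu {K L : ℕ} (r : Fin K → ℝ) : Fin (K + L) → ℝ :=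
  fun a => if ha : (a : ℕ) < K then r ⟨a, ha⟩ else 0

/-- The `(L+1) × (K+L)` constraint matrix `A` of the standard-form LP: the first `L` rows are
`(c, I_{L×L})` and the last row is `(1_K^T, 0_L^T)`. -/
def lpA {K L : ℕ} (c : Fin L → Fin K → ℝ) : Matrix (Fin (L + 1)) (Fin (K + L)) ℝ :=
  Matrix.of fun l a =>
    if hl : (l : ℕ) < L then
      if ha : (a : ℕ) < K then c ⟨l, hl⟩ ⟨a, ha⟩
      else if (a : ℕ) = K + (l : ℕ) then 1 else 0
    else if (a : ℕ) < K then 1 else 0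

/-- The right-hand side `b = (c̄, 1) ∈ ℝ^{L+1}`. -/
def lpb {L : ℕ} (cbar : Fin L → ℝ) : Fin (L + 1) → ℝ :=
  fun l => if hl : (l : ℕ) < L then cbar ⟨l, hl⟩ else 1

/-- Feasibility for the standard-form LP: `x ≥ 0` and `A x = b`. -/
def IsFeasible {K L : ℕ} (c : Fin L → Fin K → ℝ) (cbar : Fin L → ℝ)
    (x : Fin (K + L) → ℝ) : Prop :=
  (∀ i, 0 ≤ x i) ∧ lpA c *ᵥ x = lpb cbar

/-- Optimality for the standard-form LP `max {μ^T x : A x = b, x ≥ 0}`. -/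
def IsOptimal {K L : ℕ} (r : Fin K → ℝ) (c : Fin L → Fin K → ℝ) (cbar : Fin L → ℝ)
    (x : Fin (K + L) → ℝ) : Prop :=
  IsFeasible c cbar x ∧ ∀ y, IsFeasible c cbar y → lpMu (L := L) r ⬝ᵥ y ≤ lpMu (L := L) r ⬝ᵥ x

open Classical in
/-- The support of a vector, as a finset. -/
def lpSupport {n : ℕ} (x : Fin n → ℝ) : Finset (Fin n) :=
  Finset.univ.filter fun a => x a ≠ 0

/-- The square submatrix `A_J` formed by the columns of `A` indexed by the basis `J`
(in increasing order). -/
def subCols {K L : ℕ} (A : Matrix (Fin (L + 1)) (Fin (K + L)) ℝ)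
    (J : Finset (Fin (K + L))) (hJ : J.card = L + 1) :
    Matrix (Fin (L + 1)) (Fin (L + 1)) ℝ :=
  Matrix.of fun i j => A i ((J.orderIsoOfFin hJ j : J) : Fin (K + L))

/-- The subvector `μ_J` formed by the coordinates of `μ` indexed by the basis `J`
(in increasing order). -/
def subVec {K L : ℕ} (μ : Fin (K + L) → ℝ) (J : Finset (Fin (K + L)))
    (hJ : J.card = L + 1) : Fin (L + 1) → ℝ :=
  fun j => μ ((J.orderIsoOfFin hJ j : J) : Fin (K + L))

/-- A basis `J` is feasible for `(A, b)` if `A_J` is invertible and `A_J^{-1} b ≥ 0`. -/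
def BasisFeasible {K L : ℕ} (A : Matrix (Fin (L + 1)) (Fin (K + L)) ℝ)
    (b : Fin (L + 1) → ℝ) (J : Finset (Fin (K + L))) (hJ : J.card = L + 1) : Prop :=
  IsUnit (subCols A J hJ) ∧ ∀ i, 0 ≤ ((subCols A J hJ)⁻¹ *ᵥ b) i

/-- The value `μ_J^T A_J^{-1} b` of the basic solution corresponding to the basis `J`. -/
def basisValue {K L : ℕ} (μ : Fin (K + L) → ℝ) (A : Matrix (Fin (L + 1)) (Fin (K + L)) ℝ)
    (b : Fin (L + 1) → ℝ) (J : Finset (Fin (K + L))) (hJ : J.card = L + 1) : ℝ :=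
  subVec μ J hJ ⬝ᵥ ((subCols A J hJ)⁻¹ *ᵥ b)

/-- Replace the rewards of the first `K₀` arms by `rt`. -/
def modR {K K₀ : ℕ} (r : Fin K → ℝ) (rt : Fin K₀ → ℝ) : Fin K → ℝ :=
  fun a => if ha : (a : ℕ) < K₀ then rt ⟨a, ha⟩ else r a

/-- Replace the costs of the first `K₀` arms by `ct`. -/
def modC {K L K₀ : ℕ} (c : Fin L → Fin K → ℝ) (ct : Fin L → Fin K₀ → ℝ) :
    Fin L → Fin K → ℝ :=
  fun l a => if ha : (a : ℕ) < K₀ then ct l ⟨a, ha⟩ else c l a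

/-- The basis value gap `Δ_J²` (equation (8) of the paper), as an extended nonnegative real,
with `inf ∅ = +∞`. -/
def gapBasis {K L : ℕ} (K₀ : ℕ) (hK₀ : K₀ ≤ K) (σr σc : ℝ) (r : Fin K → ℝ)
    (c : Fin L → Fin K → ℝ) (cbar : Fin L → ℝ) (Istar J : Finset (Fin (K + L)))
    (hI : Istar.card = L + 1) (hJ : J.card = L + 1) : ℝ≥0∞ :=
  sInf { x : ℝ≥0∞ | ∃ (rt : Fin K₀ → ℝ) (ct : Fin L → Fin K₀ → ℝ),
    BasisFeasible (lpA (modC c ct)) (lpb cbar) Istar hI ∧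
    BasisFeasible (lpA (modC c ct)) (lpb cbar) J hJ ∧
    basisValue (lpMu (modR r rt)) (lpA (modC c ct)) (lpb cbar) Istar hI ≤
      basisValue (lpMu (modR r rt)) (lpA (modC c ct)) (lpb cbar) J hJ ∧
    x = ENNReal.ofReal ((σr ^ 2)⁻¹ * ∑ a : Fin K₀, (r (Fin.castLE hK₀ a) - rt a) ^ 2
          + (σc ^ 2)⁻¹ * ∑ l : Fin L, ∑ a : Fin K₀, (c l (Fin.castLE hK₀ a) - ct l a) ^ 2) }

/-- The arm value gap `Δ_a²` (equation (9) of the paper): the minimum of `Δ_J²` over all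
bases `J` containing `a`. -/
def gapArm {K L : ℕ} (K₀ : ℕ) (hK₀ : K₀ ≤ K) (σr σc : ℝ) (r : Fin K → ℝ)
    (c : Fin L → Fin K → ℝ) (cbar : Fin L → ℝ) (Istar : Finset (Fin (K + L)))
    (hI : Istar.card = L + 1) (a : Fin (K + L)) : ℝ≥0∞ :=
  ⨅ (J : Finset (Fin (K + L))) (hJ : J.card = L + 1) (_ : a ∈ J),
    gapBasis K₀ hK₀ σr σc r c cbar Istar J hI hJ

/-- The optimal support infeasibility gap `Δ₀²` (equation (10) of the paper), as an extended
nonnegative real, with `inf ∅ = +∞`. -/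
def gapZero {K L : ℕ} (K₀ : ℕ) (hK₀ : K₀ ≤ K) (σc : ℝ) (c : Fin L → Fin K → ℝ)
    (cbar : Fin L → ℝ) (Istar : Finset (Fin (K + L))) (hI : Istar.card = L + 1) : ℝ≥0∞ :=
  sInf { x : ℝ≥0∞ | ∃ ct : Fin L → Fin K₀ → ℝ,
    (¬ IsUnit (subCols (lpA (modC c ct)) Istar hI) ∨
      ∃ i, ((subCols (lpA (modC c ct)) Istar hI)⁻¹ *ᵥ lpb cbar) i < 0) ∧
    x = ENNReal.ofReal
          ((σc ^ 2)⁻¹ * ∑ l : Fin L, ∑ a : Fin K₀, (c l (Fin.castLE hK₀ a) - ct l a) ^ 2) }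


/-- Extension by zero of a vector indexed by a basis. -/
def extVec {K L : ℕ} (J : Finset (Fin (K + L))) (hJ : J.card = L + 1)
    (y : Fin (L + 1) → ℝ) : Fin (K + L) → ℝ :=
  fun i => if h : i ∈ J then y ((J.orderIsoOfFin hJ).symm ⟨i, h⟩) else 0

lemma extVec_apply {K L : ℕ} (J : Finset (Fin (K + L))) (hJ : J.card = L + 1)
    (y : Fin (L + 1) → ℝ) (j : Fin (L + 1)) :
    extVec J hJ y ((J.orderIsoOfFin hJ j : J) : Fin (K + L)) = y j := by
  unfold extVec
  rw [dif_pos (J.orderIsoOfFin hJ j).2]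
  simp only [Subtype.coe_eta, OrderIso.symm_apply_apply]

lemma dot_supp {K L : ℕ} (J : Finset (Fin (K + L))) (hJ : J.card = L + 1)
    (x v : Fin (K + L) → ℝ) (hx : ∀ i, i ∉ J → x i = 0) :
    v ⬝ᵥ x = subVec v J hJ ⬝ᵥ subVec x J hJ := by
  unfold dotProduct subVec
  rw [← Finset.sum_subset (Finset.subset_univ J) (fun i _ hi => by rw [hx i hi, mul_zero])]
  rw [← Finset.sum_coe_sort J]
  exact ((J.orderIsoOfFin hJ).toEquiv.sum_comp (fun i : J => v i * x i)).symm

lemma subVec_extVec {K L : ℕ} (J : Finset (Fin (K + L))) (hJ : J.card = L + 1)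
    (y : Fin (L + 1) → ℝ) : subVec (extVec J hJ y) J hJ = y := by
  funext j
  exact extVec_apply J hJ y j

lemma extVec_not_mem {K L : ℕ} (J : Finset (Fin (K + L))) (hJ : J.card = L + 1)
    (y : Fin (L + 1) → ℝ) : ∀ i, i ∉ J → extVec J hJ y i = 0 := by
  intro i hi
  unfold extVec
  rw [dif_neg hi]

lemma mulVec_supp {K L : ℕ} (A : Matrix (Fin (L + 1)) (Fin (K + L)) ℝ)
    (J : Finset (Fin (K + L))) (hJ : J.card = L + 1)
    (x : Fin (K + L) → ℝ) (hx : ∀ i, i ∉ J → x i = 0) :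
    A *ᵥ x = subCols A J hJ *ᵥ subVec x J hJ := by
  funext i
  exact dot_supp J hJ x (A i) hx

/-- A feasible basis yields a feasible point with support in the basis. -/
lemma basis_point {K L : ℕ} (c : Fin L → Fin K → ℝ) (cbar : Fin L → ℝ)
    (J : Finset (Fin (K + L))) (hJ : J.card = L + 1)
    (h : BasisFeasible (lpA c) (lpb cbar) J hJ) :
    ∃ x : Fin (K + L) → ℝ, IsFeasible c cbar x ∧ (∀ i, i ∉ J → x i = 0) ∧
      ∀ μ, basisValue μ (lpA c) (lpb cbar) J hJ = μ ⬝ᵥ x := by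
  obtain ⟨hu, hn⟩ := h
  refine ⟨extVec J hJ ((subCols (lpA c) J hJ)⁻¹ *ᵥ lpb cbar), ⟨?_, ?_⟩,
    extVec_not_mem J hJ _, ?_⟩
  · intro i
    unfold extVec
    split_ifs
    · exact hn _
    · exact le_rfl
  · rw [mulVec_supp _ J hJ _ (extVec_not_mem J hJ _), subVec_extVec, mulVec_mulVec,
      mul_nonsing_inv _ ((isUnit_iff_isUnit_det _).1 hu), one_mulVec]
  · intro μ
    rw [dot_supp J hJ _ μ (extVec_not_mem J hJ _), subVec_extVec]
    rfl

lemma lpA_row {K L : ℕ} (c : Fin L → Fin K → ℝ) (x : Fin (K + L) → ℝ) (l : Fin L) :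
    (lpA c *ᵥ x) l.castSucc = ∑ a, c l a * x (Fin.castAdd L a) + x (Fin.natAdd K l) := by
  simp only [mulVec, dotProduct, Fin.sum_univ_add, lpA, of_apply]
  congr 1
  · refine Finset.sum_congr rfl fun a _ => ?_
    simp
  · simp [Fin.val_inj]

lemma lpA_last {K L : ℕ} (c : Fin L → Fin K → ℝ) (x : Fin (K + L) → ℝ) :
    (lpA c *ᵥ x) (Fin.last L) = ∑ a, x (Fin.castAdd L a) := by
  simp only [mulVec, dotProduct, Fin.sum_univ_add, lpA, of_apply]
  simp

lemma feas_bound {K L : ℕ} (c : Fin L → Fin K → ℝ) (cbar : Fin L → ℝ)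
    (x : Fin (K + L) → ℝ) (h : IsFeasible c cbar x) (M : ℝ) (hM0 : 0 ≤ M)
    (hM : ∀ l a, |c l a| ≤ M) (i : Fin (K + L)) :
    x i ≤ 1 + ∑ l, |cbar l| + M := by
  obtain ⟨hx, hA⟩ := h
  have h1 : ∑ a, x (Fin.castAdd L a) = 1 := by
    rw [← lpA_last c x, hA]; simp [lpb]
  have hS : 0 ≤ ∑ l, |cbar l| := Finset.sum_nonneg fun l _ => abs_nonneg _
  refine Fin.addCases (fun a => ?_) (fun l => ?_) i
  · have := Finset.single_le_sum (f := fun a => x (Fin.castAdd L a)) (fun a _ => hx _)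
      (Finset.mem_univ a)
    linarith
  · have h2 : ∑ a, c l a * x (Fin.castAdd L a) + x (Fin.natAdd K l) = cbar l := by
      rw [← lpA_row c x, hA]; simp [lpb]
    have h3 : -M ≤ ∑ a, c l a * x (Fin.castAdd L a) := by
      calc -M = ∑ a, (-M) * x (Fin.castAdd L a) := by rw [← Finset.mul_sum, h1, mul_one]
        _ ≤ _ := Finset.sum_le_sum fun a _ =>
          mul_le_mul_of_nonneg_right (abs_le.1 (hM l a)).1 (hx _)
    have h4 := Finset.single_le_sum (f := fun l => |cbar l|) (fun l _ => abs_nonneg _)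
      (Finset.mem_univ l)
    have := le_abs_self (cbar l)
    linarith

lemma continuous_lpA {K L : ℕ} : Continuous (lpA : (Fin L → Fin K → ℝ) → _) := by
  refine continuous_matrix fun i j => ?_
  simp only [lpA, of_apply]
  split_ifs <;> fun_prop

lemma continuous_lpMu {K L : ℕ} : Continuous (lpMu (K := K) (L := L)) := by
  refine continuous_pi fun i => ?_
  simp only [lpMu]
  split_ifs <;> fun_prop

open Filter Topology in
lemma limit_feas {K L : ℕ} (c : Fin L → Fin K → ℝ) (cbar : Fin L → ℝ)
    (cs : ℕ → Fin L → Fin K → ℝ) (hc : Tendsto cs atTop (𝓝 c))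
    (xs : ℕ → Fin (K + L) → ℝ) (x : Fin (K + L) → ℝ) (hx : Tendsto xs atTop (𝓝 x))
    (hf : ∀ n, IsFeasible (cs n) cbar (xs n)) : IsFeasible c cbar x := by
  refine ⟨fun i => ge_of_tendsto' ((tendsto_pi_nhds.1 hx) i) fun n => (hf n).1 i, ?_⟩
  have hcont : Continuous fun p : (Fin L → Fin K → ℝ) × (Fin (K + L) → ℝ) =>
      lpA p.1 *ᵥ p.2 := (continuous_lpA.comp continuous_fst).matrix_mulVec continuous_snd
  have := (hcont.tendsto (c, x)).comp (hc.prodMk_nhds hx)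
  refine tendsto_nhds_unique this ?_
  refine Tendsto.congr (fun n => ((hf n).2).symm) tendsto_const_nhds

/-- Uniqueness and full support: the optimal basis is injective. -/
lemma opt_inj {K L : ℕ} (r : Fin K → ℝ) (c : Fin L → Fin K → ℝ) (cbar : Fin L → ℝ)
    (xstar : Fin (K + L) → ℝ)
    (hopt : IsOptimal r c cbar xstar)
    (huniq : ∀ y, IsOptimal r c cbar y → y = xstar)
    (d : Fin (K + L) → ℝ) (hd : ∀ i, i ∉ lpSupport xstar → d i = 0)
    (hA : lpA c *ᵥ d = 0) : d = 0 := by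
  obtain ⟨⟨hx, hAx⟩, ho⟩ := hopt
  have hev : ∀ᶠ t : ℝ in nhds 0, ∀ i, 0 ≤ xstar i + t * d i := by
    rw [Filter.eventually_all]
    intro i
    by_cases hi : xstar i = 0
    · have : d i = 0 := hd i (by simp [lpSupport, hi])
      simp [this, hi]
    · have hpos : 0 < xstar i := lt_of_le_of_ne (hx i) (Ne.symm hi)
      have hc : Continuous fun t : ℝ => xstar i + t * d i := by fun_prop
      have := (hc.tendsto 0).eventually (lt_mem_nhds (a := 0) (by simpa using hpos))
      exact this.mono fun t ht => ht.le
  obtain ⟨ε, hε, hball⟩ := Metric.eventually_nhds_iff.1 hev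
  have hfe : ∀ t : ℝ, |t| < ε → IsFeasible c cbar (xstar + t • d) := by
    intro t ht
    refine ⟨fun i => ?_, ?_⟩
    · have := hball (y := t) (by simpa using ht) i
      simpa using this
    · rw [mulVec_add, mulVec_smul, hA, hAx]; simp
  have hp : |ε / 2| < ε := by rw [abs_of_pos (by linarith)]; linarith
  have hm : |-(ε / 2)| < ε := by rw [abs_neg]; exact hp
  have e1 := ho _ (hfe _ hp)
  have e2 := ho _ (hfe _ hm)
  simp only [dotProduct_add, dotProduct_smul, smul_eq_mul] at e1 e2
  have h0 : lpMu (L := L) r ⬝ᵥ d = 0 := by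
    nlinarith
  have := huniq (xstar + (ε / 2) • d) ⟨hfe _ hp, fun y hy => by
    rw [dotProduct_add, dotProduct_smul, h0]
    simpa using ho y hy⟩
  have h2 : (ε / 2) • d = 0 := by simpa using this
  exact (smul_eq_zero.1 h2).resolve_left (by positivity)

lemma opt_basisFeasible {K L : ℕ} (r : Fin K → ℝ) (c : Fin L → Fin K → ℝ) (cbar : Fin L → ℝ)
    (xstar : Fin (K + L) → ℝ)
    (hopt : IsOptimal r c cbar xstar)
    (huniq : ∀ y, IsOptimal r c cbar y → y = xstar)
    (hsupp : (lpSupport xstar).card = L + 1) :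
    BasisFeasible (lpA c) (lpb cbar) (lpSupport xstar) hsupp := by
  have hu : IsUnit (subCols (lpA c) (lpSupport xstar) hsupp) := by
    rw [← mulVec_injective_iff_isUnit]
    rw [← coe_mulVecLin, ← LinearMap.ker_eq_bot, LinearMap.ker_eq_bot']
    intro y hy
    have := opt_inj r c cbar xstar hopt huniq (extVec _ hsupp y) (extVec_not_mem _ hsupp y)
      (by
        rw [mulVec_supp _ _ hsupp _ (extVec_not_mem _ hsupp y), subVec_extVec]
        simpa using hy)
    rw [← subVec_extVec _ hsupp y, this]
    rfl
  refine ⟨hu, fun i => ?_⟩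
  have hs : ∀ i, i ∉ lpSupport xstar → xstar i = 0 := by
    intro i hi
    simpa [lpSupport] using hi
  have := hopt.1.2
  rw [mulVec_supp _ _ hsupp _ hs] at this
  rw [← this, mulVec_mulVec, nonsing_inv_mul _ ((isUnit_iff_isUnit_det _).1 hu), one_mulVec]
  exact hopt.1.1 _

open Filter Topology in
/-- Compactness of feasible points along a convergent sequence of cost matrices. -/
lemma feas_subseq {K L : ℕ} (c : Fin L → Fin K → ℝ) (cbar : Fin L → ℝ)
    (cs : ℕ → Fin L → Fin K → ℝ) (hc : Tendsto cs atTop (𝓝 c))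
    (xs : ℕ → Fin (K + L) → ℝ)
    (hf : ∀ n, IsFeasible (cs n) cbar (xs n)) :
    ∃ x, ∃ φ : ℕ → ℕ, StrictMono φ ∧ Tendsto (xs ∘ φ) atTop (𝓝 x) := by
  obtain ⟨M, hM⟩ := (Metric.isBounded_range_of_tendsto cs hc).exists_norm_le
  have hM' : ∀ n l a, |cs n l a| ≤ M := fun n l a =>
    ((norm_le_pi_norm (cs n l) a).trans (norm_le_pi_norm (cs n) l)).trans
      (hM _ (Set.mem_range_self n))
  have hM0 : 0 ≤ M := (norm_nonneg _).trans (hM _ (Set.mem_range_self 0))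
  have hcomp : IsCompact (Set.Icc (0 : Fin (K + L) → ℝ)
    (fun _ => 1 + ∑ l, |cbar l| + M)) := isCompact_Icc
  obtain ⟨x, -, φ, h1, h2⟩ := hcomp.tendsto_subseq (x := xs) fun n =>
    ⟨fun i => (hf n).1 i, fun i => feas_bound _ cbar _ (hf n) M hM0 (hM' n) i⟩
  exact ⟨x, φ, h1, h2⟩

open Filter Topology in
lemma tendsto_of_sq_le (u : ℝ) (us os : ℕ → ℝ) (C : ℝ) (ho : Tendsto os atTop (𝓝 0))
    (h : ∀ n, (u - us n) ^ 2 ≤ C * os n) : Tendsto us atTop (𝓝 u) := by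
  have h1 : Tendsto (fun n => Real.sqrt (C * os n)) atTop (𝓝 0) := by
    have := (Real.continuous_sqrt.tendsto _).comp (ho.const_mul C)
    simpa [Function.comp_def] using this
  rw [tendsto_iff_dist_tendsto_zero]
  refine squeeze_zero (fun n => dist_nonneg) (fun n => ?_) h1
  rw [dist_comm, Real.dist_eq]
  exact Real.abs_le_sqrt (h n)

open Filter Topology in
lemma gapBasis_zero_imp {K L K₀ : ℕ} (hK₀ : K₀ ≤ K)
    (σr σc : ℝ) (hσr : 0 < σr) (hσc : 0 < σc)
    (r : Fin K → ℝ) (c : Fin L → Fin K → ℝ) (cbar : Fin L → ℝ)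
    (xstar : Fin (K + L) → ℝ)
    (hopt : IsOptimal r c cbar xstar)
    (huniq : ∀ y, IsOptimal r c cbar y → y = xstar)
    (hsupp : (lpSupport xstar).card = L + 1)
    (J : Finset (Fin (K + L))) (hJ : J.card = L + 1)
    (h : gapBasis K₀ hK₀ σr σc r c cbar (lpSupport xstar) J hsupp hJ = 0) :
    J = lpSupport xstar := by
  have hex : ∀ n : ℕ, ∃ (rt : Fin K₀ → ℝ) (ct : Fin L → Fin K₀ → ℝ),
      BasisFeasible (lpA (modC c ct)) (lpb cbar) (lpSupport xstar) hsupp ∧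
      BasisFeasible (lpA (modC c ct)) (lpb cbar) J hJ ∧
      basisValue (lpMu (modR r rt)) (lpA (modC c ct)) (lpb cbar) (lpSupport xstar) hsupp ≤
        basisValue (lpMu (modR r rt)) (lpA (modC c ct)) (lpb cbar) J hJ ∧
      ((σr ^ 2)⁻¹ * ∑ a : Fin K₀, (r (Fin.castLE hK₀ a) - rt a) ^ 2
          + (σc ^ 2)⁻¹ * ∑ l : Fin L, ∑ a : Fin K₀, (c l (Fin.castLE hK₀ a) - ct l a) ^ 2)
        < 1 / ((n : ℝ) + 1) := by
    intro n
    have hpos : (0 : ℝ) < 1 / ((n : ℝ) + 1) := by positivity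
    have hlt : gapBasis K₀ hK₀ σr σc r c cbar (lpSupport xstar) J hsupp hJ
        < ENNReal.ofReal (1 / ((n : ℝ) + 1)) := by
      rw [h]; exact ENNReal.ofReal_pos.2 hpos
    obtain ⟨y, ⟨rt, ct, h1, h2, h3, rfl⟩, hy⟩ := sInf_lt_iff.1 hlt
    exact ⟨rt, ct, h1, h2, h3, (ENNReal.ofReal_lt_ofReal_iff hpos).1 hy⟩
  choose rt ct h1 h2 h3 h4 using hex
  have hlim : Tendsto (fun n : ℕ => 1 / ((n : ℝ) + 1)) atTop (𝓝 0) :=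
    tendsto_one_div_add_atTop_nhds_zero_nat
  have hS1 : ∀ n, 0 ≤ ∑ a : Fin K₀, (r (Fin.castLE hK₀ a) - rt n a) ^ 2 :=
    fun n => Finset.sum_nonneg fun _ _ => sq_nonneg _
  have hS2 : ∀ n l, 0 ≤ ∑ a : Fin K₀, (c l (Fin.castLE hK₀ a) - ct n l a) ^ 2 :=
    fun n l => Finset.sum_nonneg fun _ _ => sq_nonneg _
  have hS3 : ∀ n, 0 ≤ ∑ l : Fin L, ∑ a : Fin K₀, (c l (Fin.castLE hK₀ a) - ct n l a) ^ 2 :=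
    fun n => Finset.sum_nonneg fun l _ => hS2 n l
  have hr : Tendsto (fun n => modR r (rt n)) atTop (𝓝 r) := by
    refine tendsto_pi_nhds.2 fun a => ?_
    by_cases ha : (a : ℕ) < K₀
    · simp only [modR, dif_pos ha]
      refine tendsto_of_sq_le _ _ _ (σr ^ 2) hlim fun n => ?_
      have e1 := Finset.single_le_sum
        (f := fun a : Fin K₀ => (r (Fin.castLE hK₀ a) - rt n a) ^ 2)
        (fun _ _ => sq_nonneg _) (Finset.mem_univ ⟨a, ha⟩)
      have e2 : (σr ^ 2)⁻¹ * ∑ a : Fin K₀, (r (Fin.castLE hK₀ a) - rt n a) ^ 2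
          ≤ 1 / ((n : ℝ) + 1) := by
        have := mul_nonneg (inv_nonneg.2 (sq_nonneg σc)) (hS3 n)
        linarith [h4 n]
      rw [inv_mul_le_iff₀ (by positivity)] at e2
      exact e1.trans e2
    · simp only [modR, dif_neg ha]
      exact tendsto_const_nhds
  have hc : Tendsto (fun n => modC c (ct n)) atTop (𝓝 c) := by
    refine tendsto_pi_nhds.2 fun l => tendsto_pi_nhds.2 fun a => ?_
    by_cases ha : (a : ℕ) < K₀
    · simp only [modC, dif_pos ha]
      refine tendsto_of_sq_le _ _ _ (σc ^ 2) hlim fun n => ?_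
      have e1 := Finset.single_le_sum
        (f := fun a : Fin K₀ => (c l (Fin.castLE hK₀ a) - ct n l a) ^ 2)
        (fun _ _ => sq_nonneg _) (Finset.mem_univ ⟨a, ha⟩)
      have e1' := Finset.single_le_sum
        (f := fun l => ∑ a : Fin K₀, (c l (Fin.castLE hK₀ a) - ct n l a) ^ 2)
        (fun l _ => hS2 n l) (Finset.mem_univ l)
      have e2 : (σc ^ 2)⁻¹ * ∑ l : Fin L, ∑ a : Fin K₀,
          (c l (Fin.castLE hK₀ a) - ct n l a) ^ 2 ≤ 1 / ((n : ℝ) + 1) := by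
        have := mul_nonneg (inv_nonneg.2 (sq_nonneg σr)) (hS1 n)
        linarith [h4 n]
      rw [inv_mul_le_iff₀ (by positivity)] at e2
      exact (e1.trans e1').trans e2
    · simp only [modC, dif_neg ha]
      exact tendsto_const_nhds
  choose zs hz1 hz2 hz3 using fun n => basis_point _ cbar _ hsupp (h1 n)
  choose xs hx1 hx2 hx3 using fun n => basis_point _ cbar _ hJ (h2 n)
  obtain ⟨z, φ, hφ, hz⟩ := feas_subseq c cbar _ hc zs hz1
  have hc1 := hc.comp hφ.tendsto_atTop
  obtain ⟨x, ψ, hψ, hx⟩ := feas_subseq c cbar _ hc1 (xs ∘ φ) (fun n => hx1 (φ n))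
  have hc2 := hc1.comp hψ.tendsto_atTop
  have hr2 := (hr.comp hφ.tendsto_atTop).comp hψ.tendsto_atTop
  have hz' := hz.comp hψ.tendsto_atTop
  have fz : IsFeasible c cbar z := limit_feas c cbar _ hc2 _ z hz' fun n => hz1 _
  have fx : IsFeasible c cbar x := limit_feas c cbar _ hc2 _ x hx fun n => hx1 _
  have sz : ∀ i, i ∉ lpSupport xstar → z i = 0 := fun i hi =>
    tendsto_nhds_unique (tendsto_pi_nhds.1 hz' i)
      (tendsto_const_nhds.congr fun n => (hz2 _ i hi).symm)
  have sx : ∀ i, i ∉ J → x i = 0 := fun i hi =>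
    tendsto_nhds_unique (tendsto_pi_nhds.1 hx i)
      (tendsto_const_nhds.congr fun n => (hx2 _ i hi).symm)
  have hdot : Continuous fun p : (Fin K → ℝ) × (Fin (K + L) → ℝ) =>
      lpMu (L := L) p.1 ⬝ᵥ p.2 :=
    (continuous_lpMu.comp continuous_fst).dotProduct continuous_snd
  have hval : lpMu (L := L) r ⬝ᵥ z ≤ lpMu (L := L) r ⬝ᵥ x := by
    refine le_of_tendsto_of_tendsto' ((hdot.tendsto (r, z)).comp (hr2.prodMk_nhds hz'))
      ((hdot.tendsto (r, x)).comp (hr2.prodMk_nhds hx)) fun n => ?_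
    have := h3 (φ (ψ n))
    rw [hz3, hx3] at this
    exact this
  have hzx : z = xstar := by
    have := opt_inj r c cbar xstar hopt huniq (z - xstar) (fun i hi => by
      have h0 : xstar i = 0 := by simpa [lpSupport] using hi
      simp [sz i hi, h0]) (by rw [mulVec_sub, fz.2, hopt.1.2, sub_self])
    exact sub_eq_zero.1 this
  rw [hzx] at hval
  have hxx : x = xstar := huniq x ⟨fx, fun y hy => (hopt.2 y hy).trans hval⟩
  symm
  refine Finset.eq_of_subset_of_card_le (fun i hi => ?_) (by rw [hJ, hsupp])
  by_contra hiJ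
  have h0 := sx i hiJ
  rw [hxx] at h0
  simp [lpSupport, h0] at hi

lemma gapBasis_self {K L K₀ : ℕ} (hK₀ : K₀ ≤ K) (σr σc : ℝ)
    (r : Fin K → ℝ) (c : Fin L → Fin K → ℝ) (cbar : Fin L → ℝ)
    (I : Finset (Fin (K + L))) (hI : I.card = L + 1)
    (h : BasisFeasible (lpA c) (lpb cbar) I hI) :
    gapBasis K₀ hK₀ σr σc r c cbar I I hI hI = 0 := by
  have hm : modC c (fun l (a : Fin K₀) => c l (Fin.castLE hK₀ a)) = c := by
    funext l a
    simp only [modC]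
    split_ifs
    · rfl
    · rfl
  refine le_antisymm (sInf_le ⟨fun a => r (Fin.castLE hK₀ a),
    fun l a => c l (Fin.castLE hK₀ a), ?_, ?_, le_rfl, ?_⟩) (zero_le)
  · rw [hm]; exact h
  · rw [hm]; exact h
  · simp

open Classical in
/-- Under Assumption 1, the arm value gap satisfies `Δ_a² = 0` iff `a ∈ I*`; consequently
exactly the `L+1` arms of `I*` have zero gap, and the remaining `K−1` arms have strictly
positive gap. -/
theorem gapArm_eq_zero_iff_mem_optimal_support
    (K L K₀ : ℕ) (hK : 0 < K) (hL : 0 < L) (hK₀pos : 0 < K₀) (hK₀ : K₀ ≤ K)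
    (σr σc : ℝ) (hσr : 0 < σr) (hσc : 0 < σc)
    (r : Fin K → ℝ) (c : Fin L → Fin K → ℝ) (cbar : Fin L → ℝ)
    (xstar : Fin (K + L) → ℝ)
    (hopt : IsOptimal r c cbar xstar)
    (huniq : ∀ y, IsOptimal r c cbar y → y = xstar)
    (hsupp : (lpSupport xstar).card = L + 1) :
    (∀ a : Fin (K + L),
        gapArm K₀ hK₀ σr σc r c cbar (lpSupport xstar) hsupp a = 0 ↔ a ∈ lpSupport xstar) ∧
    (Finset.univ.filter fun a : Fin (K + L) =>
        gapArm K₀ hK₀ σr σc r c cbar (lpSupport xstar) hsupp a = 0).card = L + 1 ∧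
    (Finset.univ.filter fun a : Fin (K + L) =>
        0 < gapArm K₀ hK₀ σr σc r c cbar (lpSupport xstar) hsupp a).card = K - 1 := by
  have key : ∀ a : Fin (K + L),
      gapArm K₀ hK₀ σr σc r c cbar (lpSupport xstar) hsupp a = 0 ↔ a ∈ lpSupport xstar := by
    intro a
    constructor
    · intro h
      by_contra ha
      -- the finite infimum is attained, so some basis containing `a` has zero gap
      let S : Finset (Fin (K + L)) → ℝ≥0∞ := fun J => ⨅ (hJ : J.card = L + 1) (_ : a ∈ J),
        gapBasis K₀ hK₀ σr σc r c cbar (lpSupport xstar) J hsupp hJ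
      obtain ⟨J, hJmin⟩ := exists_eq_ciInf_of_finite (f := S)
      have hJ0 : S J = 0 := hJmin.trans h
      by_cases hJ : J.card = L + 1
      · by_cases haJ : a ∈ J
        · simp only [S, hJ, haJ, iInf_true, iInf_pos] at hJ0
          have := gapBasis_zero_imp hK₀ σr σc hσr hσc r c cbar xstar hopt huniq hsupp J hJ hJ0
          exact ha (this ▸ haJ)
        · simp [S, haJ] at hJ0
      · simp [S, hJ] at hJ0
    · intro ha
      refine le_antisymm ?_ zero_le
      rw [← gapBasis_self hK₀ σr σc r c cbar (lpSupport xstar) hsupp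
        (opt_basisFeasible r c cbar xstar hopt huniq hsupp)]
      exact iInf_le_of_le _ (iInf_le_of_le hsupp (iInf_le_of_le ha le_rfl))
  refine ⟨key, ?_, ?_⟩
  · simp only [key]
    rw [Finset.filter_univ_mem, hsupp]
  · simp only [pos_iff_ne_zero, ne_eq, key]
    rw [Finset.filter_not, Finset.filter_univ_mem, Finset.card_univ_sdiff, hsupp]
    simp
    omega

end
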